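/- With the centrally extended conformal Galilei algebra relations in A and a highest weight vector v in an A-module V, set α := 2(L!)². Then for every q ∈ ℕ and every j with 0 ≤ j ≤ L: P_j · ((α·μ·C − P_{L+1}²)^q · v) = 0. -/

import Mathlib

/-- The structure constant `I_a = (-1)^(a+L+1) a! (2L+1-a)!` of the central extension. -/
def cgaI (L a : ℕ) : ℤ := (-1) ^ (a + L + 1) * a.factorial * (2 * L + 1 - a).factorial

/-- The middle structure constant is `I_L = -L! (L+1)! = -(L+1) (L!)²`. -/
theorem cgaI_self (L : ℕ) : cgaI L L = -((L + 1) * (L.factorial : ℤ) ^ 2) := by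
  have h : 2 * L + 1 - L = L + 1 := by omega
  have h2 : (-1 : ℤ) ^ (L + L + 1) = -1 := Odd.neg_one_pow ⟨L, by omega⟩
  rw [cgaI, h, h2, Nat.factorial_succ]
  push_cast
  ring

/-- With the centrally extended conformal Galilei algebra relations and
a highest weight vector `v`, for every `q` and every `0 ≤ j ≤ L`,
`P j • ((α μ C - P_{L+1}²)^q • v) = 0` where `α = 2(L!)²`. -/
theorem stmt5 (L : ℕ) (A : Type*) [Ring A] [Algebra ℝ A]
    (C D H M : A) (P : ℕ → A)
    (V : Type*) [AddCommGroup V] [Module ℝ V] [Module A V] [IsScalarTower ℝ A V]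
    (v : V) (δ μ : ℝ)
    (hPtop : P (2 * L + 2) = 0)
    (hMC : M * C = C * M) (hMD : M * D = D * M) (hMH : M * H = H * M)
    (hMP : ∀ n, n ≤ 2 * L + 1 → M * P n = P n * M)
    (hDH : D * H - H * D = 2 * H)
    (hDC : D * C - C * D = -(2 * C))
    (hCH : C * H - H * C = D)
    (hHP0 : H * P 0 - P 0 * H = 0)
    (hHP : ∀ n, 1 ≤ n → n ≤ 2 * L + 1 → H * P n - P n * H = -((n : A) * P (n - 1)))
    (hDP : ∀ n, n ≤ 2 * L + 1 →
      D * P n - P n * D = (((2 * L + 1 : ℤ) - 2 * (n : ℤ) : ℤ) : A) * P n)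
    (hCP : ∀ n, n ≤ 2 * L + 1 →
      C * P n - P n * C = ((2 * L + 1 - n : ℕ) : A) * P (n + 1))
    (hPPcomm : ∀ a b, a ≤ 2 * L + 1 → b ≤ 2 * L + 1 → a + b ≠ 2 * L + 1 →
      P a * P b = P b * P a)
    (hPP : ∀ a, a ≤ 2 * L + 1 →
      P a * P (2 * L + 1 - a) - P (2 * L + 1 - a) * P a = ((cgaI L a : ℤ) : A) * M)
    (hDv : D • v = δ • v) (hMv : M • v = μ • v) (hHv : H • v = (0 : V))
    (hPv : ∀ n, n ≤ L → P n • v = 0) :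
    ∀ (q : ℕ) (j : ℕ), j ≤ L →
      P j • ((((2 * (L.factorial : ℝ) ^ 2) * μ) • C - P (L + 1) ^ 2) ^ q • v) = 0 := by
  set r : ℝ := (2 * (L.factorial : ℝ) ^ 2) * μ with hr
  have : SMulCommClass A ℝ V := IsScalarTower.to_smulCommClass'
  have hscalar (a : A) (t : ℝ) (x : V) : a • t • x = t • a • x := smul_comm a t x
  have hstep : ∀ w : V, (∀ j, j ≤ L → P j • w = 0) → M • w = μ • w →
      (∀ j, j ≤ L → P j • ((r • C - P (L + 1) ^ 2) • w) = 0) ∧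
        M • ((r • C - P (L + 1) ^ 2) • w) = μ • ((r • C - P (L + 1) ^ 2) • w) := by
    intro w hw hMw
    have hS : (r • C - P (L + 1) ^ 2) • w = r • C • w - P (L + 1) • P (L + 1) • w := by
      rw [sub_smul, smul_assoc, sq, mul_smul (P (L + 1))]
    have hMPw (x : V) : M • P (L + 1) • x = P (L + 1) • M • x := by
      rw [← mul_smul, hMP (L + 1) (by omega), mul_smul]
    have hPC (j : ℕ) (hj : j ≤ L) :
        P j • C • w = -((2 * L + 1 - j : ℕ) • P (j + 1) • w) := by
      have h := congrArg (· • w) (hCP j (by omega))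
      simp only [sub_smul, mul_smul, hw j hj, smul_zero, zero_sub, Nat.cast_smul_eq_nsmul] at h
      rw [← h, neg_neg]
    rw [hS]
    refine ⟨fun j hj => ?_, ?_⟩
    · rw [smul_sub, hscalar, hPC j hj]
      rcases hj.lt_or_eq with hlt | rfl
      · have hcomm (x : V) : P j • P (L + 1) • x = P (L + 1) • P j • x := by
          rw [← mul_smul, hPPcomm j (L + 1) (by omega) (by omega) (by omega), mul_smul]
        rw [hcomm, hcomm, hw j hj, hw (j + 1) hlt]
        simp
      · have hmid (x : V) : P j • P (j + 1) • x =
            P (j + 1) • P j • x + (cgaI j j : ℤ) • M • x := by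
          have h := congrArg (· • x) (hPP j (by omega))
          rw [show 2 * j + 1 - j = j + 1 by omega] at h
          simp only [sub_smul, mul_smul, Int.cast_smul_eq_zsmul] at h
          rw [← h]
          abel
        rw [hmid, hmid, hw j le_rfl, hMPw, hMw, cgaI_self,
          show 2 * j + 1 - j = j + 1 by omega, smul_zero, zero_add, hscalar,
          smul_comm (P (j + 1)) (_ : ℤ), hscalar, hr, ← Int.cast_smul_eq_zsmul ℝ,
          ← Nat.cast_smul_eq_nsmul ℝ]
        generalize P (j + 1) • w = y
        push_cast
        module
    · have hMCw : M • C • w = C • M • w := by rw [← mul_smul, hMC, mul_smul]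
      rw [smul_sub, hscalar, hMCw, hMPw, hMPw, hMw]
      simp only [hscalar, smul_sub, smul_comm μ r]
  have hpow : ∀ q : ℕ, (∀ j, j ≤ L → P j • ((r • C - P (L + 1) ^ 2) ^ q • v) = 0) ∧
      M • ((r • C - P (L + 1) ^ 2) ^ q • v) = μ • ((r • C - P (L + 1) ^ 2) ^ q • v) := by
    intro q
    induction q with
    | zero => simpa using ⟨hPv, hMv⟩
    | succ q ih =>
      rw [pow_succ', mul_smul]
      exact hstep _ ih.1 ih.2
  exact fun q => (hpow q).1
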